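/- Let N ≥ 4 be divisible by 4, let n = N−1, and let λ ∈ {−1,1}^N satisfy λ_1 + ⋯ + λ_N = 0. Then there exists a nonzero polynomial p in the variables (c_1,…,c_n, a, entries of an n×n matrix R) such that for every c ∈ ℂ^n, a ∈ ℂ∖{0}, and invertible complex n×n matrix R with p(c, a, R) ≠ 0, the facet subsystem determined by (c, a, R, V(λ)) has exactly N/2 − 1 solutions x ∈ (ℂ∖{0})^n. -/

import Mathlib

noncomputable section

/-- The monomial `x^v = ∏_j x_j^{v_j}` (integer exponents). -/
def mpow {n : ℕ} (x : Fin n → ℂ) (v : Fin n → ℤ) : ℂ := ∏ j, x j ^ v j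

/-- The facet matrix `V(λ)`: its `k`-th column (`k = 1, …, N`) is `λ_k (e_{k-1} − e_k)`,
with `e_0 = e_N = 0`. -/
def facetV (N : ℕ) (lam : Fin N → ℤ) : Matrix (Fin (N - 1)) (Fin N) ℤ :=
  Matrix.of fun r k =>
    lam k * ((if (r : ℕ) + 1 = (k : ℕ) then 1 else 0) - (if (r : ℕ) = (k : ℕ) then 1 else 0))

/-- The set of solutions `x ∈ (ℂ∖{0})^{N-1}` of the facet subsystem
`c_i = a ∑_{k=1}^N (RV)_{ik} x^{v_k}`, `i = 1, …, N-1`, determined by `(c, a, R, V(λ))`. -/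
def facetSol (N : ℕ) (c : Fin (N - 1) → ℂ) (a : ℂ)
    (R : Matrix (Fin (N - 1)) (Fin (N - 1)) ℂ) (lam : Fin N → ℤ) :
    Set (Fin (N - 1) → ℂ) :=
  {x | (∀ j, x j ≠ 0) ∧
    ∀ i, c i = a * ∑ k, (∑ r, R i r * (facetV N lam r k : ℂ)) *
      mpow x (fun r => facetV N lam r k)}

open Polynomial in
/-- `∏_{λ_k = 1} (X + β_k) - ∏_{λ_k = -1} (X + β_k)`. -/
def signPoly {ι R : Type*} [Fintype ι] [CommRing R] (lam : ι → ℤ) (β : ι → R) : R[X] :=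
  ∏ k with lam k = 1, (X + C (β k)) - ∏ k with lam k = -1, (X + C (β k))

/-- If this is nonzero, then `signPoly lam β` has degree `m - 1`, is separable and does not vanish
at any `-β_k`. -/
def signPolyCert {ι R : Type*} [Fintype ι] [CommRing R] (m : ℕ) (lam : ι → ℤ) (β : ι → R) : R :=
  (signPoly lam β).coeff (m - 1) *
    (∏ k with lam k = 1, ∏ l with lam l = -1, (β k - β l)) *
      (signPoly lam β).resultant (signPoly lam β).derivative (m - 1) (m - 1 - 1)

lemma map_signPoly {ι R S : Type*} [Fintype ι] [CommRing R] [CommRing S] (φ : R →+* S)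
    (lam : ι → ℤ) (β : ι → R) :
    (signPoly lam β).map φ = signPoly lam (fun k => φ (β k)) := by
  simp [signPoly, Polynomial.map_prod]

lemma map_signPolyCert {ι R S : Type*} [Fintype ι] [CommRing R] [CommRing S] (φ : R →+* S)
    (m : ℕ) (lam : ι → ℤ) (β : ι → R) :
    φ (signPolyCert m lam β) = signPolyCert m lam (fun k => φ (β k)) := by
  rw [signPolyCert, signPolyCert, ← map_signPoly, Polynomial.derivative_map,
    Polynomial.resultant_map_map, Polynomial.coeff_map]
  simp [map_prod]

lemma sign_card {ι : Type*} [Fintype ι] {lam : ι → ℤ} (hlam : ∀ k, lam k = 1 ∨ lam k = -1)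
    (hsum : ∑ k, lam k = 0) {m : ℕ} (hm : Fintype.card ι = 2 * m) :
    (Finset.univ.filter fun k => lam k = 1).card = m ∧
      (Finset.univ.filter fun k => lam k = -1).card = m := by
  have h1 : ∀ k, lam k = (if lam k = 1 then 1 else 0) - (if lam k = -1 then 1 else 0) := by
    intro k; rcases hlam k with h | h <;> simp [h]
  have h2 : ∀ k, (1 : ℤ) = (if lam k = 1 then 1 else 0) + (if lam k = -1 then 1 else 0) := by
    intro k; rcases hlam k with h | h <;> simp [h]
  have e2 : (Fintype.card ι : ℤ) = ∑ k : ι, 1 := by simp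
  rw [Finset.sum_congr rfl fun k _ => h1 k, Finset.sum_sub_distrib, Finset.sum_boole,
    Finset.sum_boole] at hsum
  rw [Finset.sum_congr rfl fun k _ => h2 k, Finset.sum_add_distrib, Finset.sum_boole,
    Finset.sum_boole] at e2
  omega

lemma prod_sign_zpow {ι : Type*} [Fintype ι] {lam : ι → ℤ}
    (hlam : ∀ k, lam k = 1 ∨ lam k = -1) (z : ι → ℂ) :
    ∏ k, z k ^ lam k = (∏ k with lam k = 1, z k) / ∏ k with lam k = -1, z k := by
  have : ∀ k, z k ^ lam k = (if lam k = 1 then z k else 1) / (if lam k = -1 then z k else 1) := by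
    intro k; rcases hlam k with h | h <;> simp [h]
  rw [Finset.prod_congr rfl fun k _ => this k, Finset.prod_div_distrib, Finset.prod_filter,
    Finset.prod_filter]

lemma prod_scaled_sign_zpow_eq_one_iff {ι : Type*} [Fintype ι] {lam : ι → ℤ}
    (hlam : ∀ k, lam k = 1 ∨ lam k = -1) (hsum : ∑ k, lam k = 0) {m : ℕ} (hm : Even m)
    (hcard : Fintype.card ι = 2 * m) {s : ℂ} (hs : s ≠ 0) {z : ι → ℂ} (hz : ∀ k, z k ≠ 0) :
    ∏ k, (s⁻¹ * (lam k * z k)) ^ lam k = 1 ↔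
      ∏ k with lam k = 1, z k = ∏ k with lam k = -1, z k := by
  obtain ⟨hp, hq⟩ := sign_card hlam hsum hcard
  have e1 : ∏ k with lam k = 1, (s⁻¹ * (lam k * z k)) =
      s⁻¹ ^ m * ∏ k with lam k = 1, z k := by
    rw [Finset.prod_mul_distrib, Finset.prod_const, hp]
    congr 1
    refine Finset.prod_congr rfl fun k hk => ?_
    simp [(Finset.mem_filter.1 hk).2]
  have e2 : ∏ k with lam k = -1, (s⁻¹ * (lam k * z k)) =
      s⁻¹ ^ m * ∏ k with lam k = -1, z k := by
    rw [Finset.prod_mul_distrib, Finset.prod_const, hq]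
    congr 1
    have : ∀ k ∈ Finset.univ.filter (fun k => lam k = -1), (lam k * z k : ℂ) = (-1) * z k := by
      intro k hk
      simp [(Finset.mem_filter.1 hk).2]
    rw [Finset.prod_congr rfl this, Finset.prod_mul_distrib, Finset.prod_const, hq, hm.neg_one_pow,
      one_mul]
  have hs' : s⁻¹ ^ m ≠ 0 := pow_ne_zero _ (inv_ne_zero hs)
  rw [prod_sign_zpow hlam, e1, e2, mul_div_mul_left _ _ hs',
    div_eq_one_iff_eq (Finset.prod_ne_zero_iff.2 fun k _ => hz k)]

lemma eval_signPoly {ι : Type*} [Fintype ι] (lam : ι → ℤ) (β : ι → ℂ) (t : ℂ) :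
    (signPoly lam β).eval t =
      ∏ k with lam k = 1, (t + β k) - ∏ k with lam k = -1, (t + β k) := by
  simp [signPoly, Polynomial.eval_prod]

lemma natDegree_signPoly_le {ι : Type*} [Fintype ι] {lam : ι → ℤ}
    (hlam : ∀ k, lam k = 1 ∨ lam k = -1) (hsum : ∑ k, lam k = 0) {m : ℕ} (hm : 0 < m)
    (hcard : Fintype.card ι = 2 * m) (β : ι → ℂ) :
    (signPoly lam β).natDegree ≤ m - 1 := by
  obtain ⟨hp, hq⟩ := sign_card hlam hsum hcard
  have monic (s : Finset ι) : (∏ k ∈ s, (Polynomial.X + Polynomial.C (β k))).Monic :=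
    Polynomial.monic_prod_of_monic _ _ fun k _ => Polynomial.monic_X_add_C _
  have deg (s : Finset ι) : (∏ k ∈ s, (Polynomial.X + Polynomial.C (β k))).degree = (s.card : WithBot ℕ) := by
    simp [Polynomial.degree_prod]
  have := Polynomial.degree_sub_lt_left (by rw [deg, deg, hp, hq]) (monic _).ne_zero
    (by rw [(monic _).leadingCoeff, (monic _).leadingCoeff] :
      Polynomial.leadingCoeff (∏ k with lam k = 1, (Polynomial.X + Polynomial.C (β k))) =
      Polynomial.leadingCoeff (∏ k with lam k = -1, (Polynomial.X + Polynomial.C (β k))))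
  rw [deg, hp] at this
  refine Nat.le_sub_one_of_lt ?_
  by_cases h0 : signPoly lam β = 0
  · simpa [h0] using hm
  · exact (Polynomial.natDegree_lt_iff_degree_lt h0).2 this

lemma resultant_derivative_ne_zero_iff {f : Polynomial ℂ} {d : ℕ} (hd : f.natDegree = d)
    (hf : f ≠ 0) :
    f.resultant f.derivative d (d - 1) ≠ 0 ↔ f.Separable := by
  have h := Polynomial.natDegree_derivative f
  subst hd
  rw [← h, Ne, Polynomial.resultant_eq_zero_iff, Polynomial.separable_def]
  simp [hf]

lemma signPolyCert_ne_zero_iff {ι : Type*} [Fintype ι] {lam : ι → ℤ}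
    (hlam : ∀ k, lam k = 1 ∨ lam k = -1) (hsum : ∑ k, lam k = 0) {m : ℕ} (hm : 0 < m)
    (hcard : Fintype.card ι = 2 * m) (β : ι → ℂ) :
    signPolyCert m lam β ≠ 0 ↔
      (signPoly lam β).natDegree = m - 1 ∧ (signPoly lam β).Separable ∧
        ∀ k l, lam k = 1 → lam l = -1 → β k ≠ β l := by
  have hle := natDegree_signPoly_le hlam hsum hm hcard β
  have key : (signPoly lam β).coeff (m - 1) ≠ 0 →
      (signPoly lam β).natDegree = m - 1 ∧ signPoly lam β ≠ 0 := fun h =>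
    ⟨le_antisymm hle (Polynomial.le_natDegree_of_ne_zero h), fun h0 => h (by simp [h0])⟩
  simp only [signPolyCert, mul_ne_zero_iff, Finset.prod_ne_zero_iff, Finset.mem_filter,
    Finset.mem_univ, true_and, sub_ne_zero]
  constructor
  · rintro ⟨⟨h1, h2⟩, h3⟩
    obtain ⟨hd, h0⟩ := key h1
    exact ⟨hd, (resultant_derivative_ne_zero_iff hd h0).1 h3, fun k l hk hl => h2 k hk l hl⟩
  · rintro ⟨hd, hsep, h2⟩
    refine ⟨⟨?_, fun k hk l hl => h2 k l hk hl⟩,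
      (resultant_derivative_ne_zero_iff hd hsep.ne_zero).2 hsep⟩
    rw [← hd]
    exact Polynomial.leadingCoeff_ne_zero.2 hsep.ne_zero

lemma exists_prod_X_add_C_eq {ι K : Type*} [Field K] [IsAlgClosed K] (S : Finset ι)
    (F : Polynomial K) (hF : F.Monic) (hdeg : F.natDegree = S.card) :
    ∃ β : ι → K, ∏ k ∈ S, (Polynomial.X + Polynomial.C (β k)) = F := by
  classical
  induction S using Finset.induction_on generalizing F with
  | empty => exact ⟨0, by simpa using (Polynomial.eq_one_of_monic_natDegree_zero hF hdeg).symm⟩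
  | insert a S ha ih =>
    rw [Finset.card_insert_of_notMem ha] at hdeg
    obtain ⟨r, hr⟩ := IsAlgClosed.exists_root F
      (fun h => by
        rw [Polynomial.natDegree_eq_zero_iff_degree_le_zero.2 h.le] at hdeg
        omega)
    obtain ⟨G, rfl⟩ := Polynomial.dvd_iff_isRoot.2 hr
    have hG : G.Monic := (Polynomial.monic_X_sub_C r).of_mul_monic_left hF
    rw [(Polynomial.monic_X_sub_C r).natDegree_mul hG, Polynomial.natDegree_X_sub_C] at hdeg
    obtain ⟨β, hβ⟩ := ih G hG (by omega)
    refine ⟨Function.update β a (-r), ?_⟩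
    rw [Finset.prod_insert ha, Function.update_self, ← hβ, Polynomial.C_neg, ← sub_eq_add_neg]
    congr 1
    refine Finset.prod_congr rfl fun k hk => ?_
    rw [Function.update_of_ne (ne_of_mem_of_not_mem hk ha)]

lemma exists_signPolyCert_ne_zero {ι : Type*} [Fintype ι] {lam : ι → ℤ}
    (hlam : ∀ k, lam k = 1 ∨ lam k = -1) (hsum : ∑ k, lam k = 0) {m : ℕ} (hm : 2 ≤ m)
    (hcard : Fintype.card ι = 2 * m) (i : ι) :
    ∃ β : ι → ℂ, β i = 0 ∧ signPolyCert m lam β ≠ 0 := by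
  classical
  obtain ⟨hp, hq⟩ := sign_card hlam hsum hcard
  have hS : ∀ e : ℤ, e = 1 ∨ e = -1 → ∃ β : ι → ℂ,
      ∏ k with lam k = e, (Polynomial.X + Polynomial.C (β k)) =
        (Polynomial.X ^ m + (Polynomial.X ^ (m - 1) - 1) : Polynomial ℂ) ∧
      (∀ k, lam k = e → β k ≠ 0) ∧ ∀ k, lam k ≠ e → β k = 0 := by
    intro e he
    have hlow : (Polynomial.X ^ (m - 1) - 1 : Polynomial ℂ).degree < m := by
      have := Polynomial.degree_X_pow_sub_C (n := m - 1) (by omega) (1 : ℂ)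
      rw [Polynomial.C_1] at this
      rw [this]
      exact_mod_cast (by omega : m - 1 < m)
    obtain ⟨β, hβ⟩ := exists_prod_X_add_C_eq (K := ℂ)
      (Finset.univ.filter fun k => lam k = e) (Polynomial.X ^ m + (Polynomial.X ^ (m - 1) - 1))
      (Polynomial.monic_X_pow_add hlow) (by
        rw [Polynomial.natDegree_add_eq_left_of_degree_lt (by simpa using hlow)]
        rcases he with rfl | rfl <;> simp [hp, hq])
    refine ⟨fun k => if lam k = e then β k else 0, ?_, ?_, ?_⟩
    · rw [← hβ]
      refine Finset.prod_congr rfl fun k hk => ?_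
      simp [(Finset.mem_filter.1 hk).2]
    · intro k hk
      have := congrArg (Polynomial.eval 0) hβ
      simp only [Polynomial.eval_prod, Polynomial.eval_add, Polynomial.eval_X, Polynomial.eval_C,
        zero_add, Polynomial.eval_pow, Polynomial.eval_sub, Polynomial.eval_one,
        zero_pow (by omega : m ≠ 0), zero_pow (by omega : m - 1 ≠ 0)] at this
      have h2 : ∏ k with lam k = e, β k ≠ 0 := by rw [this]; norm_num
      simpa [hk] using Finset.prod_ne_zero_iff.1 h2 k (by simp [hk])
    · intro k hk
      simp [hk]
  have hsep : (Polynomial.X ^ (m - 1) - 1 : Polynomial ℂ).Separable := by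
    have := Polynomial.separable_X_pow_sub_C (n := m - 1) (1 : ℂ)
      (by exact_mod_cast (by omega : m - 1 ≠ 0)) one_ne_zero
    rwa [Polynomial.C_1] at this
  have hnat : (Polynomial.X ^ (m - 1) - 1 : Polynomial ℂ).natDegree = m - 1 := by
    have := Polynomial.natDegree_X_pow_sub_C (n := m - 1) (r := (1 : ℂ))
    rwa [Polynomial.C_1] at this
  have hX : ∀ (e : ℤ) (β : ι → ℂ), (e = 1 ∨ e = -1) → (∀ k, lam k = e → β k = 0) →
      ∏ k with lam k = e, (Polynomial.X + Polynomial.C (β k)) = Polynomial.X ^ m := by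
    intro e β he h
    rw [Finset.prod_congr rfl (g := fun _ => Polynomial.X) fun k hk => by
      rw [h k (Finset.mem_filter.1 hk).2, Polynomial.C_0, add_zero], Finset.prod_const]
    rcases he with rfl | rfl <;> simp [hp, hq]
  rcases hlam i with hi | hi
  · obtain ⟨β, h1, h2, h3⟩ := hS (-1) (Or.inr rfl)
    have h3' : ∀ k, lam k = 1 → β k = 0 := fun k hk => h3 k (by rw [hk]; norm_num)
    refine ⟨β, h3' i hi, (signPolyCert_ne_zero_iff hlam hsum (by omega) hcard β).2 ?_⟩
    have e : signPoly lam β = -(Polynomial.X ^ (m - 1) - 1) := by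
      rw [signPoly, h1, hX 1 β (Or.inl rfl) h3']; ring
    rw [e]
    refine ⟨by rw [Polynomial.natDegree_neg, hnat], ?_, ?_⟩
    · rw [Polynomial.separable_def, Polynomial.derivative_neg]
      exact (IsCoprime.neg_neg hsep)
    · intro k l hk hl
      rw [h3' k hk]
      exact (h2 l hl).symm
  · obtain ⟨β, h1, h2, h3⟩ := hS 1 (Or.inl rfl)
    have h3' : ∀ k, lam k = -1 → β k = 0 := fun k hk => h3 k (by rw [hk]; norm_num)
    refine ⟨β, h3' i hi, (signPolyCert_ne_zero_iff hlam hsum (by omega) hcard β).2 ?_⟩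
    have e : signPoly lam β = Polynomial.X ^ (m - 1) - 1 := by
      rw [signPoly, h1, hX (-1) β (Or.inr rfl) h3']; ring
    rw [e]
    refine ⟨hnat, hsep, ?_⟩
    intro k l hk hl
    rw [h3' l hl]
    exact h2 k hk

lemma eq_partialSum_iff {M : Type*} [AddCommGroup M] {n : ℕ} (b : Fin n → M)
    (z : Fin (n + 1) → M) :
    (∀ k, z k = z 0 + Fin.partialSum b k) ↔ ∀ r : Fin n, z r.succ = z r.castSucc + b r := by
  constructor
  · intro h r
    rw [h r.succ, h r.castSucc, Fin.partialSum_succ, add_assoc]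
  · intro h k
    induction k using Fin.induction with
    | zero => simp
    | succ r ih => rw [h r, ih, Fin.partialSum_succ, add_assoc]

lemma map_partialSum {R S : Type*} [CommRing R] [CommRing S] (φ : R →+* S) {n : ℕ}
    (b : Fin n → R) (k : Fin (n + 1)) :
    φ (Fin.partialSum b k) = Fin.partialSum (fun r => φ (b r)) k := by
  induction k using Fin.induction with
  | zero => simp
  | succ r ih => rw [Fin.partialSum_succ, Fin.partialSum_succ, map_add, ih]

/-- The coordinates of `x` in positions `1, …, n`, extended by `1`. -/
def padded {n : ℕ} (x : Fin n → ℂ) (i : ℕ) : ℂ := ∏ r : Fin n, if (r : ℕ) + 1 = i then x r else 1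

lemma padded_zero {n : ℕ} (x : Fin n → ℂ) : padded x 0 = 1 := by simp [padded]

lemma padded_last {n : ℕ} (x : Fin n → ℂ) : padded x (n + 1) = 1 := by
  refine Finset.prod_eq_one fun r _ => if_neg ?_
  have := r.2
  omega

lemma padded_succ {n : ℕ} (x : Fin n → ℂ) (r : Fin n) : padded x (r + 1) = x r := by
  simp [padded, Fin.val_inj]

lemma padded_ne_zero {n : ℕ} {x : Fin n → ℂ} (hx : ∀ j, x j ≠ 0) (i : ℕ) : padded x i ≠ 0 := by
  refine Finset.prod_ne_zero_iff.2 fun r _ => ?_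
  split_ifs
  exacts [hx r, one_ne_zero]

lemma mpow_facetV {n : ℕ} (lam : Fin (n + 1) → ℤ) (x : Fin n → ℂ) (k : Fin (n + 1)) :
    mpow x (fun r => facetV (n + 1) lam r k) =
      (padded x k / padded x (k + 1)) ^ lam k := by
  rw [mpow, padded, padded, ← Finset.prod_div_distrib, ← Finset.prod_zpow]
  refine Finset.prod_congr rfl fun r _ => ?_
  simp only [facetV, Matrix.of_apply, add_left_inj]
  by_cases h1 : (r : ℕ) + 1 = k
  · have h2 : (r : ℕ) ≠ k := by omega
    simp [h1, h2]
  · by_cases h2 : (r : ℕ) = k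
    · have h3 : ¬ (k : ℕ) + 1 = k := by omega
      simp [h2]
    · simp [h1, h2]

lemma sum_facetV_mul {n : ℕ} (lam : Fin (n + 1) → ℤ) (y : Fin (n + 1) → ℂ) (r : Fin n) :
    ∑ k, (facetV (n + 1) lam r k : ℂ) * y k =
      lam r.succ * y r.succ - lam r.castSucc * y r.castSucc := by
  have : ∀ k, (facetV (n + 1) lam r k : ℂ) * y k =
      (if r.succ = k then lam k * y k else 0) - (if r.castSucc = k then lam k * y k else 0) := by
    intro k
    simp only [facetV, Matrix.of_apply, Fin.ext_iff, Fin.val_succ, Fin.val_castSucc]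
    split_ifs <;> simp
  rw [Finset.sum_congr rfl fun k _ => this k, Finset.sum_sub_distrib]
  simp

/-- The quantities `s λ_k x^{v_k}`, where `v_k` is the `k`-th column of the facet matrix. -/
def scaledTerm {n : ℕ} (lam : Fin (n + 1) → ℤ) (s : ℂ) (x : Fin n → ℂ) (k : Fin (n + 1)) : ℂ :=
  s * (lam k * (padded x k / padded x (k + 1)) ^ lam k)

lemma mem_facetSol_iff {n : ℕ} (lam : Fin (n + 1) → ℤ) (c : Fin n → ℂ) (a : ℂ)
    {R : Matrix (Fin n) (Fin n) ℂ} (hR : IsUnit R) (x : Fin n → ℂ) :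
    x ∈ facetSol (n + 1) c a R lam ↔ (∀ j, x j ≠ 0) ∧
      ∀ k, scaledTerm lam (a * R.det) x k =
        scaledTerm lam (a * R.det) x 0 + Fin.partialSum (R.adjugate.mulVec c) k := by
  have hdet : R.det ≠ 0 := ((Matrix.isUnit_iff_isUnit_det R).1 hR).ne_zero
  rw [eq_partialSum_iff]
  set y : Fin (n + 1) → ℂ := fun k => (padded x k / padded x (k + 1)) ^ lam k with hy
  set w : Fin n → ℂ := fun r => lam r.succ * y r.succ - lam r.castSucc * y r.castSucc with hw
  have h1 : x ∈ facetSol (n + 1) c a R lam ↔ (∀ j, x j ≠ 0) ∧ c = a • R.mulVec w := by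
    refine and_congr Iff.rfl (Iff.trans (forall_congr' fun i => ?_) funext_iff.symm)
    have : ∑ k, (∑ r, R i r * (facetV (n + 1) lam r k : ℂ)) *
        mpow x (fun r => facetV (n + 1) lam r k) = R.mulVec w i := by
      simp only [mpow_facetV, Matrix.mulVec, dotProduct, hw, ← sum_facetV_mul, Finset.sum_mul,
        Finset.mul_sum, mul_assoc]
      exact Finset.sum_comm
    rw [Pi.smul_apply, smul_eq_mul, ← this]
    rfl
  rw [h1]
  refine and_congr Iff.rfl ?_
  have h2 : c = a • R.mulVec w ↔ R.adjugate.mulVec c = (a * R.det) • w := by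
    constructor
    · intro h
      rw [h, Matrix.mulVec_smul, Matrix.mulVec_mulVec, Matrix.adjugate_mul, Matrix.smul_mulVec,
        Matrix.one_mulVec, smul_smul]
    · intro h
      have := congrArg R.mulVec h
      rw [Matrix.mulVec_mulVec, Matrix.mul_adjugate, Matrix.smul_mulVec, Matrix.one_mulVec,
        Matrix.mulVec_smul, mul_comm, mul_smul] at this
      exact smul_right_injective _ hdet this
  rw [h2, funext_iff]
  refine forall_congr' fun r => ?_
  have e : ∀ k, scaledTerm lam (a * R.det) x k = a * R.det * (lam k * y k) := fun k => rfl
  rw [e, e, Pi.smul_apply, smul_eq_mul, hw, mul_sub, eq_sub_iff_add_eq, add_comm, eq_comm]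

lemma prod_padded_div {n : ℕ} {x : Fin n → ℂ} (hx : ∀ j, x j ≠ 0) :
    ∏ k : Fin (n + 1), padded x k / padded x (k + 1) = 1 := by
  rw [Fin.prod_univ_eq_prod_range (fun k => padded x k / padded x (k + 1)) (n + 1)]
  have : ∀ N, ∏ k ∈ Finset.range N, padded x k / padded x (k + 1) = padded x 0 / padded x N := by
    intro N
    induction N with
    | zero => simp [padded_zero]
    | succ N ih =>
      rw [Finset.prod_range_succ, ih]
      have := padded_ne_zero hx N
      field_simp
  rw [this, padded_zero, padded_last, div_one]

lemma padded_div_injective {n : ℕ} {x x' : Fin n → ℂ} (hx' : ∀ j, x' j ≠ 0)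
    (h : ∀ k : Fin (n + 1), padded x k / padded x (k + 1) = padded x' k / padded x' (k + 1)) :
    x = x' := by
  have key : ∀ i ≤ n, padded x i = padded x' i := by
    intro i
    induction i with
    | zero => intro _; rw [padded_zero, padded_zero]
    | succ i ih =>
      intro hi
      have h1 := h ⟨i, by omega⟩
      simp only [ih (by omega)] at h1
      simpa [div_eq_mul_inv, padded_ne_zero hx' i] using h1
  funext j
  rw [← padded_succ x j, ← padded_succ x' j]
  exact key _ (by omega)

lemma exists_padded_div {n : ℕ} {w : Fin (n + 1) → ℂ} (hw : ∀ k, w k ≠ 0) (hprod : ∏ k, w k = 1) :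
    ∃ x : Fin n → ℂ, (∀ j, x j ≠ 0) ∧ ∀ k : Fin (n + 1), padded x k / padded x (k + 1) = w k := by
  set v : ℕ → ℂ := fun i => if h : i < n + 1 then w ⟨i, h⟩ else 1 with hv
  have hv0 : ∀ i, v i ≠ 0 := by
    intro i
    simp only [hv]
    split_ifs
    exacts [hw _, one_ne_zero]
  have hvw : ∀ k : Fin (n + 1), v k = w k := fun k => dif_pos k.2
  have hP : ∀ i, ∏ l ∈ Finset.range i, v l ≠ 0 := fun i =>
    Finset.prod_ne_zero_iff.2 fun l _ => hv0 l
  set x : Fin n → ℂ := fun j => (∏ l ∈ Finset.range (j + 1), v l)⁻¹ with hxdef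
  have hx : ∀ i ≤ n + 1, padded x i = (∏ l ∈ Finset.range i, v l)⁻¹ := by
    intro i hi
    rcases i with _ | i
    · simp [padded_zero]
    · rcases (by omega : i < n ∨ i = n) with h | rfl
      · exact padded_succ x ⟨i, h⟩
      · rw [padded_last, ← Fin.prod_univ_eq_prod_range, Finset.prod_congr rfl fun k _ => hvw k,
          hprod, inv_one]
  refine ⟨x, fun j => inv_ne_zero (hP _), fun k => ?_⟩
  rw [hx _ (by omega), hx _ (by omega), Finset.prod_range_succ, ← hvw k]
  have := hP k
  have := hv0 k
  field_simp

lemma add_ne_zero_of_isRoot_signPoly {ι : Type*} [Fintype ι] {lam : ι → ℤ}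
    (hlam : ∀ k, lam k = 1 ∨ lam k = -1) {β : ι → ℂ}
    (hβ : ∀ k l, lam k = 1 → lam l = -1 → β k ≠ β l) {t : ℂ} (ht : (signPoly lam β).IsRoot t)
    (k : ι) : t + β k ≠ 0 := by
  rw [Polynomial.IsRoot, eval_signPoly, sub_eq_zero] at ht
  intro h
  rcases hlam k with hk | hk
  · rw [Finset.prod_eq_zero (i := k) (by simp [hk]) h] at ht
    obtain ⟨l, hl, h'⟩ := Finset.prod_eq_zero_iff.1 ht.symm
    exact hβ k l hk (Finset.mem_filter.1 hl).2 (add_left_cancel (h.trans h'.symm))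
  · rw [Finset.prod_eq_zero (s := Finset.univ.filter fun k => lam k = -1) (i := k)
      (by simp [hk]) h] at ht
    obtain ⟨l, hl, h'⟩ := Finset.prod_eq_zero_iff.1 ht
    exact hβ l k (Finset.mem_filter.1 hl).2 hk (add_left_cancel (h'.trans h.symm))

lemma sign_zpow_zpow {e : ℤ} (he : e = 1 ∨ e = -1) (z : ℂ) : (z ^ e) ^ e = z := by
  rcases he with rfl | rfl <;> simp

lemma sign_cast_mul_self {e : ℤ} (he : e = 1 ∨ e = -1) (z : ℂ) : (e : ℂ) * (e * z) = z := by
  rcases he with rfl | rfl <;> simp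

lemma bijOn_facetSol {n m : ℕ} {lam : Fin (n + 1) → ℤ} (hlam : ∀ k, lam k = 1 ∨ lam k = -1)
    (hsum : ∑ k, lam k = 0) (hm : Even m) (hcard : n + 1 = 2 * m) (c : Fin n → ℂ) {a : ℂ}
    (ha : a ≠ 0) {R : Matrix (Fin n) (Fin n) ℂ} (hR : IsUnit R)
    (hβ : ∀ k l, lam k = 1 → lam l = -1 →
      Fin.partialSum (R.adjugate.mulVec c) k ≠ Fin.partialSum (R.adjugate.mulVec c) l) :
    Set.BijOn (fun x => scaledTerm lam (a * R.det) x 0) (facetSol (n + 1) c a R lam)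
      {t | (signPoly lam (Fin.partialSum (R.adjugate.mulVec c))).IsRoot t} := by
  have hdet : R.det ≠ 0 := ((Matrix.isUnit_iff_isUnit_det R).1 hR).ne_zero
  have hs : a * R.det ≠ 0 := mul_ne_zero ha hdet
  set s := a * R.det
  set β := Fin.partialSum (R.adjugate.mulVec c) with hβdef
  have ratio : ∀ (x : Fin n → ℂ) (k : Fin (n + 1)),
      (s⁻¹ * (lam k * scaledTerm lam s x k)) ^ lam k = padded x k / padded x (k + 1) := by
    intro x k
    rw [scaledTerm, mul_left_comm (lam k : ℂ), inv_mul_cancel_left₀ hs, sign_cast_mul_self (hlam k),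
      sign_zpow_zpow (hlam k)]
  have hcard' : Fintype.card (Fin (n + 1)) = 2 * m := by simpa using hcard
  refine ⟨?_, ?_, ?_⟩
  · intro x hx
    obtain ⟨hx0, hx1⟩ := (mem_facetSol_iff lam c a hR x).1 hx
    have hz : ∀ k, scaledTerm lam s x k ≠ 0 := by
      intro k
      refine mul_ne_zero hs (mul_ne_zero ?_ (zpow_ne_zero _
        (div_ne_zero (padded_ne_zero hx0 _) (padded_ne_zero hx0 _))))
      rcases hlam k with h | h <;> simp [h]
    have h := (prod_scaled_sign_zpow_eq_one_iff hlam hsum hm hcard' hs hz).1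
      (by rw [Finset.prod_congr rfl fun k _ => ratio x k, prod_padded_div hx0])
    rw [Set.mem_ofPred_eq, Polynomial.IsRoot, eval_signPoly, sub_eq_zero]
    rwa [Finset.prod_congr rfl fun k _ => hx1 k,
      Finset.prod_congr (s₁ := Finset.univ.filter fun k => lam k = -1) rfl fun k _ => hx1 k] at h
  · intro x hx x' hx' h
    obtain ⟨-, hx1⟩ := (mem_facetSol_iff lam c a hR x).1 hx
    obtain ⟨hx0', hx1'⟩ := (mem_facetSol_iff lam c a hR x').1 hx'
    refine padded_div_injective hx0' fun k => ?_
    rw [← ratio, ← ratio, hx1, hx1', show scaledTerm lam s x 0 = scaledTerm lam s x' 0 from h]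
  · intro t ht
    have hne := add_ne_zero_of_isRoot_signPoly hlam hβ ht
    have hprod := (prod_scaled_sign_zpow_eq_one_iff hlam hsum hm hcard' hs hne).2 (by
      rwa [Set.mem_ofPred_eq, Polynomial.IsRoot, eval_signPoly, sub_eq_zero] at ht)
    obtain ⟨x, hx0, hx1⟩ := exists_padded_div (fun k => zpow_ne_zero _ (mul_ne_zero
      (inv_ne_zero hs) (mul_ne_zero (by rcases hlam k with h | h <;> simp [h]) (hne k)))) hprod
    have hterm : ∀ k, scaledTerm lam s x k = t + β k := by
      intro k
      rw [scaledTerm, hx1, sign_zpow_zpow (hlam k), mul_left_comm (lam k : ℂ),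
        mul_inv_cancel_left₀ hs, sign_cast_mul_self (hlam k)]
    have h0 : scaledTerm lam s x 0 = t := by rw [hterm, hβdef, Fin.partialSum_zero, add_zero]
    exact ⟨x, (mem_facetSol_iff lam c a hR x).2 ⟨hx0, fun k => by rw [h0]; exact hterm k⟩, h0⟩

lemma facetSol_finite_and_ncard {n m : ℕ} {lam : Fin (n + 1) → ℤ}
    (hlam : ∀ k, lam k = 1 ∨ lam k = -1) (hsum : ∑ k, lam k = 0) (hm : Even m) (hm0 : 0 < m)
    (hcard : n + 1 = 2 * m) (c : Fin n → ℂ) {a : ℂ}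
    (ha : a ≠ 0) {R : Matrix (Fin n) (Fin n) ℂ} (hR : IsUnit R)
    (hcert : signPolyCert m lam (Fin.partialSum (R.adjugate.mulVec c)) ≠ 0) :
    (facetSol (n + 1) c a R lam).Finite ∧ (facetSol (n + 1) c a R lam).ncard = m - 1 := by
  obtain ⟨hdeg, hsep, hβ⟩ :=
    (signPolyCert_ne_zero_iff hlam hsum hm0 (by simpa using hcard) _).1 hcert
  have hbij := bijOn_facetSol hlam hsum hm hcard c ha hR hβ
  set f := signPoly lam (Fin.partialSum (R.adjugate.mulVec c))
  have hroots : {t | f.IsRoot t} = f.roots.toFinset := by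
    ext t
    simp [hsep.ne_zero]
  rw [hroots] at hbij
  refine ⟨hbij.finite_iff_finite.2 (Finset.finite_toSet _), ?_⟩
  rw [← hbij.injOn.ncard_image, hbij.image_eq, Set.ncard_coe_finset,
    Multiset.toFinset_card_of_nodup (Polynomial.nodup_roots hsep), ← hdeg]
  exact (IsAlgClosed.splits f).natDegree_eq_card_roots.symm

/-- The generic vector `adj(R) c`. -/
def genericRhs (n : ℕ) (r : Fin n) : MvPolynomial (Fin n ⊕ Unit ⊕ (Fin n × Fin n)) ℂ :=
  (Matrix.of fun i j => MvPolynomial.X (Sum.inr (Sum.inr (i, j)))).adjugate.mulVec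
    (fun i => MvPolynomial.X (Sum.inl i)) r

lemma eval_genericRhs {n : ℕ} (c : Fin n → ℂ) (a : ℂ) (R : Matrix (Fin n) (Fin n) ℂ) (r : Fin n) :
    MvPolynomial.eval (Sum.elim c (Sum.elim (fun _ => a) (fun ij => R ij.1 ij.2)))
      (genericRhs n r) = R.adjugate.mulVec c r := by
  rw [genericRhs, RingHom.map_mulVec, ← RingHom.mapMatrix_apply, RingHom.map_adjugate]
  set φ := MvPolynomial.eval
    (Sum.elim c (Sum.elim (fun _ : Unit => a) fun ij : Fin n × Fin n => R ij.1 ij.2)) with hφ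
  have hM : φ.mapMatrix (Matrix.of fun i j => MvPolynomial.X (Sum.inr (Sum.inr (i, j)))) = R := by
    ext i j
    simp [hφ]
  have hv : φ ∘ (fun i => MvPolynomial.X (Sum.inl i)) = c := by
    ext i
    simp [hφ]
  rw [hM, hv]

lemma eval_generic_signPolyCert {n : ℕ} (m : ℕ) (lam : Fin (n + 1) → ℤ) (c : Fin n → ℂ) (a : ℂ)
    (R : Matrix (Fin n) (Fin n) ℂ) :
    MvPolynomial.eval (Sum.elim c (Sum.elim (fun _ => a) (fun ij => R ij.1 ij.2)))
      (signPolyCert m lam (Fin.partialSum (genericRhs n))) =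
        signPolyCert m lam (Fin.partialSum (R.adjugate.mulVec c)) := by
  rw [map_signPolyCert]
  congr 1
  funext k
  rw [map_partialSum]
  congr 1
  funext r
  exact eval_genericRhs c a R r

/-- for `N ≥ 4` divisible by `4` and a balanced sign vector `λ ∈ {−1,1}^N`,
there is a nonzero polynomial `p` in `(c, a, R)` such that whenever `a ≠ 0`, `R` is
invertible, and `p(c, a, R) ≠ 0`, the facet subsystem determined by `(c, a, R, V(λ))`
has exactly `N/2 − 1` solutions in `(ℂ∖{0})^n`. -/
theorem facet_subsystem_count_div_four (N : ℕ) (hN : 4 ≤ N) (hdvd : 4 ∣ N)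
    (lam : Fin N → ℤ) (hlam : ∀ k, lam k = 1 ∨ lam k = -1)
    (hsum : ∑ k, lam k = 0) :
    ∃ p : MvPolynomial (Fin (N - 1) ⊕ Unit ⊕ (Fin (N - 1) × Fin (N - 1))) ℂ, p ≠ 0 ∧
      ∀ (c : Fin (N - 1) → ℂ) (a : ℂ) (R : Matrix (Fin (N - 1)) (Fin (N - 1)) ℂ),
        a ≠ 0 → IsUnit R →
        MvPolynomial.eval
            (Sum.elim c (Sum.elim (fun _ => a) (fun ij => R ij.1 ij.2))) p ≠ 0 →
        (facetSol N c a R lam).Finite ∧ (facetSol N c a R lam).ncard = N / 2 - 1 := by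
  obtain ⟨n, rfl⟩ : ∃ n, N = n + 1 := ⟨N - 1, by omega⟩
  obtain ⟨q, hq⟩ := hdvd
  have hcard : n + 1 = 2 * (2 * q) := by omega
  have hhalf : (n + 1) / 2 = 2 * q := by omega
  refine ⟨signPolyCert (2 * q) lam (Fin.partialSum (genericRhs n)), ?_, ?_⟩
  · obtain ⟨β, hβ0, hβ⟩ := exists_signPolyCert_ne_zero hlam hsum (m := 2 * q) (by omega)
      (by simpa using hcard) 0
    intro h
    have h1 := eval_generic_signPolyCert (2 * q) lam
      (fun r => β r.succ - β r.castSucc) 1 1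
    have h2 : Fin.partialSum (fun r => β r.succ - β r.castSucc) = β := by
      funext k
      rw [((eq_partialSum_iff (fun r => β r.succ - β r.castSucc) β).2 fun r => by ring) k, hβ0,
        zero_add]
    rw [h, map_zero, Matrix.adjugate_one, Matrix.one_mulVec, h2] at h1
    exact hβ h1.symm
  · intro c a R ha hR hp
    rw [hhalf]
    exact facetSol_finite_and_ncard hlam hsum (even_two_mul q) (by omega) hcard c ha hR
      (by rw [← eval_generic_signPolyCert (2 * q) lam c a R]; exact hp)
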